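/- Let d ≥ 2, 0 < α < 1, let h_α(t) := Σ_{k=0}^∞ 2^{−kα} cos(2π·2^k t), let a > 0 satisfy a·d·Σ_{k=0}^∞ 2^{−kα} ≤ 1/2, and let W(x,y) := 1/2 + a Σ_{i=1}^d h_α(x_i − y_i) on [0,1]^d × [0,1]^d. Then Ψ_q(W) < ∞ for every q with 0 < q < d/α. -/

import Mathlib

open MeasureTheory
open scoped ENNReal

/-- The unit cube `[0,1]^d` in Euclidean space. -/
def unitCube (d : ℕ) : Set (EuclideanSpace ℝ (Fin d)) :=
  {x | ∀ i, x i ∈ Set.Icc (0:ℝ) 1}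

/-- The smoothness functional
`Ψ_q(W) = ∫∫ (∫ |W(x,z) − W(y,z)| dμ(z))^{−q} dμ(x) dμ(y) ∈ [0,∞]`. -/
noncomputable def Psi {S : Type*} [MeasurableSpace S] (μ : Measure S) (q : ℝ)
    (W : S → S → ℝ) : ℝ≥0∞ :=
  ∫⁻ x, ∫⁻ y, (∫⁻ z, ENNReal.ofReal |W x z - W y z| ∂μ) ^ (-q) ∂μ ∂μ

/-- The Weierstrass function `h_α(t) = Σ_{k≥0} 2^{−kα} cos(2π·2^k t)`. -/
noncomputable def weierstrass (α : ℝ) (t : ℝ) : ℝ :=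
  ∑' k : ℕ, (2:ℝ) ^ (-(k:ℝ) * α) * Real.cos (2 * Real.pi * 2 ^ k * t)

/-- The Weierstrass-type graphon `W(x,y) = 1/2 + a Σ_i h_α(x_i − y_i)` on `[0,1]^d`. -/
noncomputable def weierstrassGraphon (d : ℕ) (α a : ℝ)
    (x y : EuclideanSpace ℝ (Fin d)) : ℝ :=
  1 / 2 + a * ∑ i, weierstrass α (x i - y i)


/-- Lebesgue measure on the unit interval. -/
noncomputable abbrev unitMeasure : Measure ℝ := volume.restrict (Set.Icc (0:ℝ) 1)

instance : IsProbabilityMeasure unitMeasure := ⟨by simp⟩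

theorem measurePreserving_ofLp_unitCube (d : ℕ) :
    MeasurePreserving (MeasurableEquiv.toLp 2 (Fin d → ℝ)).symm (volume.restrict (unitCube d))
      (Measure.pi fun _ : Fin d => unitMeasure) := by
  have h := (EuclideanSpace.volume_preserving_symm_measurableEquiv_toLp
    (Fin d)).restrict_preimage_emb (MeasurableEquiv.measurableEmbedding _)
    (Set.pi Set.univ fun _ => Set.Icc (0:ℝ) 1)
  have hs : (MeasurableEquiv.toLp 2 (Fin d → ℝ)).symm ⁻¹'
      (Set.pi Set.univ fun _ => Set.Icc (0:ℝ) 1) = unitCube d := by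
    ext x
    simp only [unitCube, Set.mem_preimage, Set.mem_univ_pi, Set.mem_ofPred_eq]
    rfl
  rw [volume_pi, Measure.restrict_pi_pi, hs] at h
  exact h

theorem integral_unitMeasure (f : ℝ → ℝ) : ∫ u, f u ∂unitMeasure = ∫ u in (0:ℝ)..1, f u := by
  rw [intervalIntegral.integral_of_le zero_le_one, integral_Icc_eq_integral_Ioc]

theorem integrable_pi_unitMeasure {d : ℕ} {f : (Fin d → ℝ) → ℝ} (hf : Continuous f) :
    Integrable f (Measure.pi fun _ : Fin d => unitMeasure) := by
  rw [← Measure.restrict_pi_pi]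
  exact hf.continuousOn.integrableOn_compact (isCompact_univ_pi fun _ => isCompact_Icc)

theorem integrable_unitMeasure {f : ℝ → ℝ} (hf : Continuous f) : Integrable f unitMeasure :=
  hf.continuousOn.integrableOn_compact isCompact_Icc

/-! ### Fourier coefficients of the Weierstrass function -/

theorem summable_two_rpow {α : ℝ} (hα : 0 < α) :
    Summable fun k : ℕ => (2:ℝ) ^ (-(k:ℝ) * α) := by
  have h : ∀ k : ℕ, (2:ℝ) ^ (-(k:ℝ) * α) = ((2:ℝ) ^ (-α)) ^ k := fun k => by
    rw [← Real.rpow_natCast, ← Real.rpow_mul (by norm_num)]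
    ring_nf
  simp_rw [h]
  exact summable_geometric_of_lt_one (by positivity)
    (Real.rpow_lt_one_of_one_lt_of_neg (by norm_num) (by linarith))

theorem continuous_weierstrass {α : ℝ} (hα : 0 < α) : Continuous (weierstrass α) := by
  refine continuous_tsum (fun k => by fun_prop) (summable_two_rpow hα) fun k t => ?_
  rw [norm_mul, Real.norm_of_nonneg (by positivity)]
  exact mul_le_of_le_one_right (by positivity) (Real.abs_cos_le_one _)

theorem integral_sin_int_mul_add {n : ℤ} (hn : n ≠ 0) (c : ℝ) :
    ∫ u in (0:ℝ)..1, Real.sin (2 * Real.pi * n * u + c) = 0 := by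
  have hn' : (n:ℝ) ≠ 0 := by exact_mod_cast hn
  have h0 : 2 * Real.pi * n ≠ 0 := mul_ne_zero (by positivity) hn'
  rw [intervalIntegral.integral_comp_mul_add (fun u => Real.sin u) h0, integral_sin]
  have : Real.cos (2 * Real.pi * n * 1 + c) = Real.cos c := by
    rw [show 2 * Real.pi * n * 1 + c = c + n * (2 * Real.pi) by ring,
      Real.cos_add_int_mul_two_pi]
  rw [this]
  simp

theorem integral_cos_mul_sin (n m : ℕ) (hn : n ≠ 0) (x c : ℝ) :
    ∫ u in (0:ℝ)..1, Real.cos (2 * Real.pi * n * (x - u)) * Real.sin (2 * Real.pi * m * (u - c)) =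
      if n = m then Real.sin (2 * Real.pi * m * (x - c)) / 2 else 0 := by
  have key : ∀ u : ℝ,
      Real.cos (2 * Real.pi * n * (x - u)) * Real.sin (2 * Real.pi * m * (u - c)) =
      (1 / 2) * Real.sin (2 * Real.pi * ((m - n : ℤ) : ℝ) * u + 2 * Real.pi * (n * x - m * c)) +
      (1 / 2) * Real.sin (2 * Real.pi * ((m + n : ℤ) : ℝ) * u +
        (-(2 * Real.pi * (n * x + m * c)))) := by
    intro u
    rw [show 2 * Real.pi * ((m - n : ℤ) : ℝ) * u + 2 * Real.pi * (n * x - m * c) =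
        2 * Real.pi * m * (u - c) + 2 * Real.pi * n * (x - u) by push_cast; ring,
      show 2 * Real.pi * ((m + n : ℤ) : ℝ) * u + (-(2 * Real.pi * (n * x + m * c))) =
        2 * Real.pi * m * (u - c) - 2 * Real.pi * n * (x - u) by push_cast; ring,
      Real.sin_add, Real.sin_sub]
    ring
  simp_rw [key]
  rw [intervalIntegral.integral_add (Continuous.intervalIntegrable (by fun_prop) _ _)
      (Continuous.intervalIntegrable (by fun_prop) _ _),
    intervalIntegral.integral_const_mul, intervalIntegral.integral_const_mul,
    integral_sin_int_mul_add (n := (m + n : ℤ)) (by omega)]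
  split_ifs with h
  · subst h
    simp
    ring_nf
  · rw [integral_sin_int_mul_add (by omega)]
    simp

theorem integral_weierstrass_mul_sin {α : ℝ} (hα : 0 < α) (k : ℕ) (x c : ℝ) :
    ∫ u, weierstrass α (x - u) * Real.sin (2 * Real.pi * 2 ^ k * (u - c)) ∂unitMeasure =
      (2:ℝ) ^ (-(k:ℝ) * α) * (Real.sin (2 * Real.pi * 2 ^ k * (x - c)) / 2) := by
  have hsum := hasSum_integral_of_summable_integral_norm (μ := unitMeasure)
    (F := fun (l : ℕ) u => (2:ℝ) ^ (-(l:ℝ) * α) * Real.cos (2 * Real.pi * 2 ^ l * (x - u)) *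
      Real.sin (2 * Real.pi * 2 ^ k * (u - c)))
    (fun l => integrable_unitMeasure (by fun_prop)) (by
      refine Summable.of_nonneg_of_le (fun l => by positivity) (fun l => ?_)
        (summable_two_rpow hα)
      refine (integral_mono_of_nonneg (.of_forall fun u => by positivity)
        (integrable_const ((2:ℝ) ^ (-(l:ℝ) * α))) (.of_forall fun u => ?_)).trans (by simp)
      simp only [norm_mul]
      rw [Real.norm_of_nonneg (by positivity : (0:ℝ) ≤ (2:ℝ) ^ (-(l:ℝ) * α)), mul_assoc]
      exact mul_le_of_le_one_right (by positivity)
        (mul_le_one₀ (Real.abs_cos_le_one _) (abs_nonneg _) (Real.abs_sin_le_one _)))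
  simp only [tsum_mul_right] at hsum
  refine hsum.unique ?_
  have hterm : ∀ l : ℕ, ∫ u, (2:ℝ) ^ (-(l:ℝ) * α) * Real.cos (2 * Real.pi * 2 ^ l * (x - u)) *
      Real.sin (2 * Real.pi * 2 ^ k * (u - c)) ∂unitMeasure =
      if l = k then (2:ℝ) ^ (-(k:ℝ) * α) * (Real.sin (2 * Real.pi * 2 ^ k * (x - c)) / 2)
      else 0 := by
    intro l
    simp_rw [mul_assoc ((2:ℝ) ^ (-(l:ℝ) * α))]
    rw [integral_const_mul, integral_unitMeasure]
    have h := integral_cos_mul_sin (2 ^ l) (2 ^ k) (by positivity) x c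
    push_cast at h
    rw [h]
    by_cases hlk : l = k
    · subst hlk; simp
    · simp [hlk]
  simp_rw [hterm]
  exact hasSum_ite_eq k _

theorem integral_comp_eval_mul_comp_eval_of_ne {d : ℕ} {i j : Fin d} (hij : i ≠ j) (f g : ℝ → ℝ) :
    ∫ z, f (z i) * g (z j) ∂(Measure.pi fun _ : Fin d => unitMeasure) =
      (∫ u, f u ∂unitMeasure) * ∫ u, g u ∂unitMeasure := by
  have h := integral_fintype_prod_eq_prod (𝕜 := ℝ) (μ := fun _ : Fin d => unitMeasure)
    (fun l u => if l = i then f u else if l = j then g u else 1)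
  have hprod : ∀ F G : Fin d → ℝ, (∏ l, if l = i then F l else if l = j then G l else 1) =
      F i * G j := by
    intro F G
    rw [← Finset.prod_subset (Finset.subset_univ {i, j}), Finset.prod_pair hij]
    · simp [hij.symm]
    · intro l _ hl
      simp only [Finset.mem_insert, Finset.mem_singleton, not_or] at hl
      simp [hl.1, hl.2]
  rw [← hprod (fun _ => ∫ u, f u ∂unitMeasure) (fun _ => ∫ u, g u ∂unitMeasure)]
  simp_rw [← hprod (fun l => f _) (fun l => g _)]
  convert h using 2
  split_ifs <;> simp

/-- Testing `z ↦ W(x,z) − W(y,z)` against a sine of frequency `2^k` in the `i`-th coordinate. -/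
theorem le_lintegral_abs_sub {d : ℕ} {α a : ℝ} (hα : 0 < α) (ha : 0 < a) (x y : Fin d → ℝ)
    (i : Fin d) (k : ℕ) :
    ENNReal.ofReal (a * (2:ℝ) ^ (-(k:ℝ) * α) * |Real.sin (Real.pi * 2 ^ k * (x i - y i))|) ≤
      ∫⁻ z, ENNReal.ofReal |(1 / 2 + a * ∑ j, weierstrass α (x j - z j)) -
        (1 / 2 + a * ∑ j, weierstrass α (y j - z j))|
        ∂(Measure.pi fun _ : Fin d => unitMeasure) := by
  have hc := continuous_weierstrass hα
  set c : ℝ := (x i + y i) / 2 with hcdef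
  set φ : ℝ → ℝ := fun u => Real.sin (2 * Real.pi * 2 ^ k * (u - c)) with hφ
  have hφc : Continuous φ := by fun_prop
  set F : (Fin d → ℝ) → ℝ := fun z => (1 / 2 + a * ∑ j, weierstrass α (x j - z j)) -
        (1 / 2 + a * ∑ j, weierstrass α (y j - z j)) with hF
  have hFc : Continuous F := by fun_prop
  rw [← ofReal_integral_eq_lintegral_ofReal (integrable_pi_unitMeasure hFc.abs)
    (.of_forall fun z => abs_nonneg _)]
  refine ENNReal.ofReal_le_ofReal ?_
  have hφ0 : ∫ u, φ u ∂unitMeasure = 0 := by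
    rw [integral_unitMeasure]
    have h := integral_sin_int_mul_add (n := 2 ^ k) (by positivity) (-(2 * Real.pi * 2 ^ k * c))
    push_cast at h
    rw [← h]
    congr 1 with u
    rw [hφ]
    ring_nf
  have hcoef : ∫ z, F z * φ (z i) ∂(Measure.pi fun _ : Fin d => unitMeasure) =
      a * ((2:ℝ) ^ (-(k:ℝ) * α) * Real.sin (Real.pi * 2 ^ k * (x i - y i))) := by
    have hexp : ∀ z, F z * φ (z i) = ∑ j, a * ((weierstrass α (x j - z j) -
        weierstrass α (y j - z j)) * φ (z i)) := by
      intro z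
      rw [← Finset.mul_sum, ← Finset.sum_mul, Finset.sum_sub_distrib, hF]
      ring
    simp_rw [hexp]
    rw [integral_finsetSum _ fun j _ => integrable_pi_unitMeasure (by fun_prop),
      Finset.sum_eq_single i]
    · rw [integral_const_mul, integral_comp_eval (μ := fun _ : Fin d => unitMeasure) (i := i)
        (f := fun u => (weierstrass α (x i - u) - weierstrass α (y i - u)) * φ u)
        (by fun_prop)]
      simp_rw [sub_mul]
      rw [integral_sub (integrable_unitMeasure (by fun_prop))
        (integrable_unitMeasure (by fun_prop)), integral_weierstrass_mul_sin hα,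
        integral_weierstrass_mul_sin hα,
        show 2 * Real.pi * 2 ^ k * (x i - c) = Real.pi * 2 ^ k * (x i - y i) by
          rw [hcdef]; ring,
        show 2 * Real.pi * 2 ^ k * (y i - c) = -(Real.pi * 2 ^ k * (x i - y i)) by
          rw [hcdef]; ring, Real.sin_neg]
      ring
    · intro j _ hj
      rw [integral_const_mul, integral_comp_eval_mul_comp_eval_of_ne hj
        (fun u => weierstrass α (x j - u) - weierstrass α (y j - u)) φ, hφ0]
      simp
    · simp
  calc a * (2:ℝ) ^ (-(k:ℝ) * α) * |Real.sin (Real.pi * 2 ^ k * (x i - y i))|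
      = |∫ z, F z * φ (z i) ∂(Measure.pi fun _ : Fin d => unitMeasure)| := by
        rw [hcoef, abs_mul, abs_mul, abs_of_pos ha,
          abs_of_pos (a := (2:ℝ) ^ (-(k:ℝ) * α)) (by positivity), mul_assoc]
    _ ≤ ∫ z, |F z * φ (z i)| ∂(Measure.pi fun _ : Fin d => unitMeasure) :=
        abs_integral_le_integral_abs
    _ ≤ _ := by
        refine integral_mono (integrable_pi_unitMeasure (by fun_prop))
          (integrable_pi_unitMeasure hFc.abs) fun z => ?_
        rw [abs_mul]
        exact mul_le_of_le_one_right (abs_nonneg _) (Real.abs_sin_le_one _)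

/-! ### The integrable majorant -/

theorem exists_two_rpow_mul_abs_sin_ge {α s : ℝ} (hα : 0 < α) (hs0 : s ≠ 0) (hs : |s| ≤ 1 / 2) :
    ∃ k : ℕ, |s| ^ α / 2 ≤ (2:ℝ) ^ (-(k:ℝ) * α) * |Real.sin (Real.pi * 2 ^ k * s)| := by
  have hpos : 0 < |s| := abs_pos.2 hs0
  obtain ⟨k, hk1, hk2⟩ := exists_nat_pow_near (x := 1 / (2 * |s|)) (y := (2:ℝ))
    (by rw [le_div_iff₀ (by positivity)]; linarith) (by norm_num)
  rw [le_div_iff₀ (by positivity)] at hk1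
  rw [div_lt_iff₀ (by positivity), pow_succ] at hk2
  refine ⟨k, ?_⟩
  have hpi := Real.pi_pos
  have hsin : 1 / 2 ≤ |Real.sin (Real.pi * 2 ^ k * s)| := by
    have h1 := Real.mul_le_sin (x := Real.pi * (2 ^ k * |s|)) (by positivity) (by nlinarith)
    have h2 : 2 / Real.pi * (Real.pi * (2 ^ k * |s|)) = 2 * (2 ^ k * |s|) := by
      field_simp
    have h3 : |Real.sin (Real.pi * 2 ^ k * s)| = |Real.sin (Real.pi * (2 ^ k * |s|))| := by
      rcases abs_choice s with h | h <;> rw [h]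
      · ring_nf
      · rw [show Real.pi * (2 ^ k * -s) = -(Real.pi * 2 ^ k * s) by ring, Real.sin_neg, abs_neg]
    rw [h3]
    exact le_trans (by linarith) (h1.trans (le_abs_self _))
  have hpow : |s| ^ α ≤ (2:ℝ) ^ (-(k:ℝ) * α) := by
    rw [Real.rpow_mul (by norm_num), Real.rpow_neg (by norm_num), Real.rpow_natCast]
    refine Real.rpow_le_rpow hpos.le ?_ hα.le
    rw [← one_div, le_div_iff₀ (by positivity)]
    linarith
  calc |s| ^ α / 2 = |s| ^ α * (1 / 2) := by ring
    _ ≤ _ := mul_le_mul hpow hsin (by norm_num) (by positivity)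

/-- The sum of `|t - m|^{-r}` over `m ∈ {-1, 0, 1}`, which dominates the power `-r` of the distance
from `t ∈ [-1, 1]` to the nearest integer. -/
noncomputable def singularKernel (r t : ℝ) : ℝ≥0∞ :=
  ENNReal.ofReal |t| ^ (-r) + ENNReal.ofReal |t - 1| ^ (-r) + ENNReal.ofReal |t + 1| ^ (-r)

@[fun_prop]
theorem measurable_singularKernel (r : ℝ) : Measurable (singularKernel r) := by
  unfold singularKernel
  fun_prop

theorem exists_int_abs_sub_le_half {t : ℝ} (ht : |t| ≤ 1) :
    ∃ m : ℤ, |t - m| ≤ 1 / 2 ∧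
      ∀ r, ENNReal.ofReal |t - m| ^ (-r) ≤ singularKernel r t := by
  rw [abs_le] at ht
  rcases le_total t (-(1 / 2)) with h | h
  · refine ⟨-1, ?_, fun r => ?_⟩
    · rw [abs_le]; push_cast; constructor <;> linarith
    · simp [singularKernel]
  rcases le_total t (1 / 2) with h' | h'
  · refine ⟨0, ?_, fun r => ?_⟩
    · rw [abs_le]; push_cast; constructor <;> linarith
    · simp [singularKernel, add_assoc]
  · refine ⟨1, ?_, fun r => ?_⟩
    · rw [abs_le]; push_cast; constructor <;> linarith
    · simp only [singularKernel, Int.cast_one]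
      exact le_add_right le_add_self

theorem abs_sin_two_pow_mul_sub_int (k : ℕ) (t : ℝ) (m : ℤ) :
    |Real.sin (Real.pi * 2 ^ k * (t - m))| = |Real.sin (Real.pi * 2 ^ k * t)| := by
  rw [show Real.pi * 2 ^ k * (t - m) = Real.pi * 2 ^ k * t - ((2 ^ k * m : ℤ) : ℝ) * Real.pi by
    push_cast; ring, Real.sin_sub_int_mul_pi, abs_mul]
  simp [abs_zpow]

theorem rpow_neg_le_singularKernel {α a p t : ℝ} {D : ℝ≥0∞} (hα : 0 < α) (ha : 0 < a) (hp : 0 < p)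
    (ht : |t| ≤ 1)
    (hD : ∀ k : ℕ, ENNReal.ofReal (a * (2:ℝ) ^ (-(k:ℝ) * α) *
      |Real.sin (Real.pi * 2 ^ k * t)|) ≤ D) :
    D ^ (-p) ≤ ENNReal.ofReal (a / 2) ^ (-p) * singularKernel (α * p) t := by
  obtain ⟨m, hm, hker⟩ := exists_int_abs_sub_le_half ht
  refine le_trans ?_ (mul_le_mul_right (hker (α * p)) _)
  by_cases h0 : t - m = 0
  · have h1 : ENNReal.ofReal (a / 2) ^ (-p) ≠ 0 := by simp [hp.not_gt]
    have h2 : ENNReal.ofReal |t - m| ^ (-(α * p)) = ∞ := by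
      rw [h0]; simp [ENNReal.zero_rpow_of_neg, mul_pos hα hp]
    rw [h2, ENNReal.mul_top h1]
    exact le_top
  obtain ⟨k, hk⟩ := exists_two_rpow_mul_abs_sin_ge hα h0 hm
  rw [abs_sin_two_pow_mul_sub_int] at hk
  have hpos : 0 < |t - m| := abs_pos.2 h0
  have hle : ENNReal.ofReal (a / 2) * ENNReal.ofReal |t - m| ^ α ≤ D := by
    rw [ENNReal.ofReal_rpow_of_pos hpos, ← ENNReal.ofReal_mul (by positivity)]
    refine (ENNReal.ofReal_le_ofReal ?_).trans (hD k)
    nlinarith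
  calc D ^ (-p) ≤ (ENNReal.ofReal (a / 2) * ENNReal.ofReal |t - m| ^ α) ^ (-p) := by
        rw [ENNReal.rpow_neg, ENNReal.rpow_neg]
        exact ENNReal.inv_le_inv.2 (ENNReal.rpow_le_rpow hle hp.le)
    _ = _ := by
        rw [ENNReal.mul_rpow_of_ne_top ENNReal.ofReal_ne_top
          (ENNReal.rpow_ne_top_of_nonneg hα.le ENNReal.ofReal_ne_top), ← ENNReal.rpow_mul, mul_neg]

theorem intervalIntegrable_abs_rpow {r : ℝ} (hr : -1 < r) (b : ℝ) (hb : 0 ≤ b) :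
    IntervalIntegrable (fun v : ℝ => |v| ^ r) volume (-b) b := by
  have h : IntervalIntegrable (fun v : ℝ => |v| ^ r) volume 0 b := by
    refine (intervalIntegral.intervalIntegrable_rpow' (a := 0) (b := b) hr).congr ?_
    intro v hv
    rw [Set.uIoc_of_le hb] at hv
    simp only [abs_of_pos hv.1]
  have h' := (IntervalIntegrable.iff_comp_neg (by simp)).1 h
  simp only [abs_neg, neg_zero] at h'
  exact h'.symm.trans h

theorem lintegral_abs_rpow_lt_top {r : ℝ} (hr : r < 1) (b : ℝ) (hb : 0 ≤ b) :
    ∫⁻ v in Set.Icc (-b) b, ENNReal.ofReal |v| ^ (-r) < ∞ := by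
  have h := intervalIntegrable_abs_rpow (r := -r) (by linarith) b hb
  rw [intervalIntegrable_iff_integrableOn_Icc_of_le (by linarith)] at h
  refine lt_of_le_of_lt (lintegral_mono_ae ?_) h.hasFiniteIntegral
  refine ae_restrict_of_ae ?_
  filter_upwards [Measure.ae_ne volume (0:ℝ)] with v hv
  rw [ENNReal.ofReal_rpow_of_pos (abs_pos.2 hv), ← ofReal_norm]
  exact ENNReal.ofReal_le_ofReal (le_abs_self _)

theorem lintegral_unitMeasure_abs_sub_rpow_le (r : ℝ) {c : ℝ} (hc : c ∈ Set.Icc (-1:ℝ) 2) :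
    ∫⁻ u, ENNReal.ofReal |c - u| ^ (-r) ∂unitMeasure ≤
      ∫⁻ v in Set.Icc (-2:ℝ) 2, ENNReal.ofReal |v| ^ (-r) := by
  rw [← lintegral_indicator measurableSet_Icc, ← lintegral_indicator measurableSet_Icc,
    ← lintegral_sub_left_eq_self (Set.indicator (Set.Icc (-2:ℝ) 2) _) c]
  refine lintegral_mono (Set.indicator_le fun u hu => ?_)
  rw [Set.indicator_of_mem]
  constructor <;> linarith [hu.1, hu.2, hc.1, hc.2]

theorem lintegral_singularKernel_le (r : ℝ) {c : ℝ} (hc : c ∈ Set.Icc (0:ℝ) 1) :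
    ∫⁻ u, singularKernel r (c - u) ∂unitMeasure ≤
      3 * ∫⁻ v in Set.Icc (-2:ℝ) 2, ENNReal.ofReal |v| ^ (-r) := by
  unfold singularKernel
  rw [lintegral_add_left (by fun_prop), lintegral_add_left (by fun_prop),
    show (3 : ℝ≥0∞) = 1 + 1 + 1 by norm_num, add_mul, add_mul, one_mul]
  have h1 : ∀ u, c - u - 1 = (c - 1) - u := fun u => by ring
  have h2 : ∀ u, c - u + 1 = (c + 1) - u := fun u => by ring
  simp_rw [h1, h2]
  refine add_le_add (add_le_add ?_ ?_) ?_ <;>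
    exact lintegral_unitMeasure_abs_sub_rpow_le _ ⟨by linarith [hc.1], by linarith [hc.2]⟩

theorem lintegral_pi_prod {d : ℕ} {f : Fin d → ℝ → ℝ≥0∞} (hf : ∀ i, Measurable (f i)) :
    ∫⁻ z, ∏ i, f i (z i) ∂(Measure.pi fun _ : Fin d => unitMeasure) =
      ∏ i, ∫⁻ u, f i u ∂unitMeasure := by
  have hind := ProbabilityTheory.iIndepFun_pi (μ := fun _ : Fin d => unitMeasure) (X := f)
    fun i => (hf i).aemeasurable
  rw [ProbabilityTheory.lintegral_prod_eq_prod_lintegral_of_indepFun Finset.univ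
    (fun i (z : Fin d → ℝ) => f i (z i)) hind (fun i => by fun_prop)]
  refine Finset.prod_congr rfl fun i _ => ?_
  exact (measurePreserving_eval (fun _ : Fin d => unitMeasure) i).lintegral_comp (hf i)

theorem ae_mem_Icc_pi (d : ℕ) : ∀ᵐ z ∂(Measure.pi fun _ : Fin d => unitMeasure),
    ∀ i, z i ∈ Set.Icc (0:ℝ) 1 := by
  rw [← Measure.restrict_pi_pi]
  filter_upwards [ae_restrict_mem (MeasurableSet.univ_pi fun _ => measurableSet_Icc)] with z hz i
  exact hz i trivial

/-- **Lemma 4.** For the Weierstrass-type graphon on `[0,1]^d`,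
`Ψ_q(W) < ∞` for every `0 < q < d/α`. -/
theorem Psi_weierstrassGraphon_lt_top (d : ℕ) (hd : 2 ≤ d)
    (α : ℝ) (hα0 : 0 < α) (hα1 : α < 1) (a : ℝ) (ha : 0 < a)
    (ha' : a * d * ∑' k : ℕ, (2:ℝ) ^ (-(k:ℝ) * α) ≤ 1 / 2)
    (q : ℝ) (hq0 : 0 < q) (hqd : q < d / α) :
    Psi (volume.restrict (unitCube d)) q (weierstrassGraphon d α a) < ∞ := by
  have hd0 : (0:ℝ) < d := by exact_mod_cast (by omega : 0 < d)
  set ν := Measure.pi fun _ : Fin d => unitMeasure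
  set W : (Fin d → ℝ) → (Fin d → ℝ) → ℝ :=
    fun x y => 1 / 2 + a * ∑ i, weierstrass α (x i - y i)
  have htr : ∀ f : (Fin d → ℝ) → ℝ≥0∞,
      ∫⁻ x, f ((MeasurableEquiv.toLp 2 (Fin d → ℝ)).symm x) ∂(volume.restrict (unitCube d)) =
        ∫⁻ x, f x ∂ν := fun f =>
    (measurePreserving_ofLp_unitCube d).lintegral_comp_emb
      (MeasurableEquiv.measurableEmbedding _) f
  have hPsi : Psi (volume.restrict (unitCube d)) q (weierstrassGraphon d α a) = Psi ν q W := by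
    unfold Psi
    rw [← htr]
    refine lintegral_congr fun x => ?_
    rw [← htr]
    refine lintegral_congr fun y => ?_
    rw [← htr]
    rfl
  rw [hPsi]
  set p : ℝ := q / d with hp
  have hp0 : 0 < p := by positivity
  have hr : α * p < 1 := by
    rw [lt_div_iff₀ hα0] at hqd
    rw [hp, ← mul_div_assoc, div_lt_one hd0]
    linarith
  set C : ℝ≥0∞ := ENNReal.ofReal (a / 2) ^ (-p)
  have hC : C ≠ ∞ := by
    simp only [C, ENNReal.rpow_neg]
    simp [ENNReal.rpow_eq_zero_iff, ha, hp0.not_gt]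
  set M : ℝ≥0∞ := ∫⁻ v in Set.Icc (-2:ℝ) 2, ENNReal.ofReal |v| ^ (-(α * p))
  have hM : M < ∞ := lintegral_abs_rpow_lt_top hr 2 (by norm_num)
  have hpt : ∀ x y : Fin d → ℝ, (∀ i, x i ∈ Set.Icc (0:ℝ) 1) → (∀ i, y i ∈ Set.Icc (0:ℝ) 1) →
      (∫⁻ z, ENNReal.ofReal |W x z - W y z| ∂ν) ^ (-q) ≤
        ∏ i, C * singularKernel (α * p) (x i - y i) := by
    intro x y hx hy
    have hpow : ∀ D : ℝ≥0∞, D ^ (-q) = ∏ _i : Fin d, D ^ (-p) := fun D => by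
      rw [Finset.prod_const, Finset.card_univ, Fintype.card_fin, ← ENNReal.rpow_natCast,
        ← ENNReal.rpow_mul, hp]
      congr 1
      field_simp
    rw [hpow]
    refine Finset.prod_le_prod' fun i _ => rpow_neg_le_singularKernel hα0 ha hp0 ?_
      fun k => le_lintegral_abs_sub hα0 ha x y i k
    rw [abs_le]
    constructor <;> linarith [(hx i).1, (hx i).2, (hy i).1, (hy i).2]
  calc Psi ν q W ≤ ∫⁻ _x, (C * (3 * M)) ^ d ∂ν := by
        refine lintegral_mono_ae ?_
        filter_upwards [ae_mem_Icc_pi d] with x hx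
        calc _ ≤ ∫⁻ y, ∏ i, C * singularKernel (α * p) (x i - y i) ∂ν := by
              refine lintegral_mono_ae ?_
              filter_upwards [ae_mem_Icc_pi d] with y hy
              exact hpt x y hx hy
          _ = ∏ i, ∫⁻ u, C * singularKernel (α * p) (x i - u) ∂unitMeasure :=
              lintegral_pi_prod (f := fun i u => C * singularKernel (α * p) (x i - u))
                fun i => by fun_prop
          _ ≤ ∏ _i : Fin d, C * (3 * M) := by
              refine Finset.prod_le_prod' fun i _ => ?_
              rw [lintegral_const_mul _ (by fun_prop)]
              gcongr
              exact lintegral_singularKernel_le _ (hx i)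
          _ = _ := by simp
    _ < ∞ := by
        rw [lintegral_const]
        simp only [ν, measure_univ, mul_one]
        exact ENNReal.pow_lt_top
          (ENNReal.mul_lt_top hC.lt_top (ENNReal.mul_lt_top (by simp) hM))
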